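/- (Series form of the OPRA capacity, eq. (30) of the proof of Theorem 5.) For all real parameters m > 0, k > 0, γ̄ > 0, γ₀ > 0: ∫_{γ₀}^∞ log₂(γ/γ₀) · f(γ) dγ = (γ₀/ln 2) · ∫₀^∞ (m^m (k+1) x^{m−1} / ((k + m x)^m γ̄)) · e^{−x} · ∑_{i=0}^∞ ((m)_i/(i!)²) · (k(k+1)γ₀/(x(k+m x)γ̄))^i · (∫₁^∞ (ln t) · t^i · e^{−((k+1)γ₀/(x γ̄)) t} dt) dx, with all integrals and series convergent. -/

import Mathlib

open MeasureTheory Set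

/-- Pochhammer symbol (rising factorial) `(m)_i = m(m+1)⋯(m+i−1)`. -/
noncomputable def poch (m : ℝ) (i : ℕ) : ℝ := ∏ j ∈ Finset.range i, (m + j)

/-- `n`-th harmonic number `H_n = ∑_{j=1}^n 1/j` (with `H_0 = 0`). -/
noncomputable def harmonicR (n : ℕ) : ℝ := ∑ j ∈ Finset.range n, 1 / ((j : ℝ) + 1)

/-- Kummer confluent hypergeometric function `₁F₁(m, 1, z) = ∑_{i=0}^∞ ((m)_i/(i!)²) z^i`. -/
noncomputable def kummerM (m z : ℝ) : ℝ :=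
  ∑' i : ℕ, poch m i / ((Nat.factorial i : ℝ) ^ 2) * z ^ i

/-- Kummer confluent hypergeometric function of the second kind
`U(a, b, z) = (1/Γ(a)) ∫₀^∞ e^{−zt} t^{a−1} (1+t)^{b−a−1} dt`. -/
noncomputable def kummerU (a b z : ℝ) : ℝ :=
  (1 / Real.Gamma a) *
    ∫ t in Ioi (0 : ℝ), Real.exp (-z * t) * t ^ (a - 1) * (1 + t) ^ (b - a - 1)

/-- Conditional SNR density of the fdRLoS channel,
`f(γ|x)` with `k_x = k/x`, `γ̄_x = ((k+x)/(k+1))·γ̄`. -/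
noncomputable def condPdf (m k γb x γ : ℝ) : ℝ :=
  (m ^ m * (1 + k / x)) / ((m + k / x) ^ m * ((k + x) / (k + 1) * γb)) *
    Real.exp (-((1 + k / x) / ((k + x) / (k + 1) * γb)) * γ) *
    kummerM m ((k / x) * (1 + k / x) / (k / x + m) * (γ / ((k + x) / (k + 1) * γb)))

/-- Unconditional SNR density of the fdRLoS channel, `f(γ) = ∫₀^∞ f(γ|x) e^{−x} dx`. -/
noncomputable def pdfSNR (m k γb γ : ℝ) : ℝ :=
  ∫ x in Ioi (0 : ℝ), condPdf m k γb x γ * Real.exp (-x)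


lemma poch_pos {m : ℝ} (hm : 0 < m) (i : ℕ) : 0 < poch m i :=
  Finset.prod_pos fun j _ => by positivity

lemma poch_succ (m : ℝ) (i : ℕ) : poch m (i + 1) = poch m i * (m + i) :=
  Finset.prod_range_succ _ _

lemma poch_le {m : ℝ} (hm : 0 < m) (i : ℕ) :
    poch m i ≤ (m + 1) ^ i * (Nat.factorial i : ℝ) := by
  induction i with
  | zero => simp [poch]
  | succ n ih =>
    rw [poch_succ, Nat.factorial_succ, pow_succ]
    push_cast
    have h : m + n ≤ (m + 1) * (n + 1) := by nlinarith [mul_nonneg hm.le (Nat.cast_nonneg (α := ℝ) n)]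
    calc poch m n * (m + n) ≤ ((m + 1) ^ n * (Nat.factorial n : ℝ)) * ((m + 1) * (n + 1)) := by
          gcongr
      _ = _ := by ring

lemma poch_shift {m : ℝ} (i : ℕ) : m * poch (m + 1) i = poch m i * (m + i) := by
  induction i with
  | zero => simp [poch]
  | succ n ih =>
    rw [poch_succ, poch_succ, ← mul_assoc, ih]
    push_cast
    ring

lemma poch_weight {m : ℝ} (hm : 0 < m) (i : ℕ) :
    poch m i * (i + 1) ≤ (1 + m) * poch (m + 1) i := by
  have h := poch_shift (m := m) i
  have hp := poch_pos hm i
  have : m * (poch m i * (i + 1)) ≤ m * ((1 + m) * poch (m + 1) i) := by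
    have e : m * ((1 + m) * poch (m + 1) i) = (1 + m) * (poch m i * (m + i)) := by rw [← h]; ring
    rw [e]
    have : 0 ≤ poch m i * (m + i + m * m - m + 0) + poch m i * (m) := by
      have : 0 ≤ poch m i * (m + i + m * m) := by positivity
      nlinarith
    nlinarith [mul_nonneg hp.le (Nat.cast_nonneg (α := ℝ) i), mul_pos hp (mul_pos hm hm)]
  exact le_of_mul_le_mul_left this hm

lemma kummer_summable {m : ℝ} (hm : 0 < m) (z : ℝ) :
    Summable (fun i : ℕ => poch m i / ((Nat.factorial i : ℝ) ^ 2) * z ^ i) := by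
  refine Summable.of_norm_bounded (Real.summable_pow_div_factorial ((m + 1) * |z|)) fun i => ?_
  have hp := poch_pos hm i
  rw [norm_mul, norm_pow, Real.norm_eq_abs, Real.norm_eq_abs, abs_of_nonneg (by positivity), mul_pow]
  have := poch_le hm i
  have hf : (0 : ℝ) < Nat.factorial i := by positivity
  calc poch m i / ((Nat.factorial i : ℝ) ^ 2) * |z| ^ i
      ≤ ((m + 1) ^ i * (Nat.factorial i : ℝ)) / ((Nat.factorial i : ℝ) ^ 2) * |z| ^ i := by gcongr
    _ = _ := by field_simp

lemma kummer_measurable {m : ℝ} (hm : 0 < m) : Measurable (kummerM m) := by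
  refine measurable_of_tendsto_metrizable (f := fun n z => ∑ i ∈ Finset.range n,
    poch m i / ((Nat.factorial i : ℝ) ^ 2) * z ^ i) (fun n => by fun_prop) ?_
  rw [tendsto_pi_nhds]
  exact fun z => (kummer_summable hm z).hasSum.tendsto_sum_nat

lemma negbin {a w : ℝ} (hw : 0 ≤ w) (hw1 : w < 1) :
    HasSum (fun i : ℕ => poch a i / (Nat.factorial i : ℝ) * w ^ i) (1 / (1 - w) ^ a) := by
  have h := (Real.one_div_one_sub_rpow_hasFPowerSeriesOnBall_zero a).hasSum (y := w)
    (by simp [enorm_eq_nnnorm]; rw [← NNReal.coe_lt_coe]; simp [abs_of_nonneg hw, hw1])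
  simp only [zero_add] at h
  refine Eq.mpr (congrArg (fun g : ℕ → ℝ => HasSum g (1 / (1 - w) ^ a)) (funext fun i => ?_)) h
  have hc : poch a i / (Nat.factorial i : ℝ) = Ring.choose (a + i - 1) i := by
    rw [← Ring.multichoose_eq, div_eq_iff (by positivity)]
    have := Ring.factorial_nsmul_multichoose_eq_ascPochhammer a i
    rw [nsmul_eq_mul, mul_comm] at this
    rw [this, ← Polynomial.ascPochhammer_smeval_cast ℝ, ← Polynomial.eval_eq_smeval]
    clear this h
    induction i with
    | zero => simp [poch]
    | succ n ih => rw [poch_succ, ascPochhammer_succ_eval, ih]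
  rw [hc]
  simp [FormalMultilinearSeries.ofScalars, mul_comm]

lemma gammaInt {A : ℝ} (hA : 0 < A) (i : ℕ) :
    IntegrableOn (fun t : ℝ => t ^ (i + 1) * Real.exp (-A * t)) (Ioi 0) ∧
    ∫ t in Ioi (0:ℝ), t ^ (i + 1) * Real.exp (-A * t) = (Nat.factorial (i + 1) : ℝ) / A ^ (i + 2) := by
  constructor
  · have h := integrableOn_rpow_mul_exp_neg_mul_rpow (p := 1) (s := (i + 1 : ℕ)) (b := A)
      (by have : (0:ℝ) ≤ ((i+1 : ℕ) : ℝ) := by positivity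
          linarith) one_pos hA
    simpa only [Real.rpow_natCast, Real.rpow_one] using h
  · have h := Real.integral_rpow_mul_exp_neg_mul_Ioi (a := (i + 2 : ℕ)) (r := A) (by positivity) hA
    rw [show ((i + 2 : ℕ) : ℝ) = ((i + 1 : ℕ) : ℝ) + 1 by push_cast; ring, add_sub_cancel_right,
      Real.Gamma_nat_eq_factorial, ← Nat.cast_add_one] at h
    simp only [Real.rpow_natCast] at h
    simp only [neg_mul]
    rw [h]
    simp [div_eq_inv_mul]

lemma logTerm {A : ℝ} (hA : 0 < A) (i : ℕ) :
    IntegrableOn (fun t : ℝ => Real.log t * t ^ i * Real.exp (-A * t)) (Ioi 1) ∧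
    ∫ t in Ioi (1:ℝ), Real.log t * t ^ i * Real.exp (-A * t)
      ≤ (Nat.factorial (i + 1) : ℝ) / A ^ (i + 2) := by
  obtain ⟨h1, h2⟩ := gammaInt hA i
  have h3 := h1.mono_set (Ioi_subset_Ioi (zero_le_one (α := ℝ)))
  have hle : ∀ t ∈ Ioi (1:ℝ), Real.log t * t ^ i * Real.exp (-A * t)
      ≤ t ^ (i + 1) * Real.exp (-A * t) := by
    intro t ht
    have ht : 1 < t := ht
    have : Real.log t ≤ t := by linarith [Real.log_le_sub_one_of_pos (zero_lt_one.trans ht)]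
    rw [pow_succ']
    gcongr
  have hI : IntegrableOn (fun t : ℝ => Real.log t * t ^ i * Real.exp (-A * t)) (Ioi 1) := by
    refine h3.mono' (by fun_prop) ?_
    filter_upwards [ae_restrict_mem measurableSet_Ioi] with t ht
    have ht' : 1 < t := ht
    have := Real.log_pos ht'
    rw [Real.norm_of_nonneg (by positivity)]
    exact hle t ht
  refine ⟨hI, (setIntegral_mono_on hI h3 measurableSet_Ioi hle).trans ?_⟩
  rw [← h2]
  refine setIntegral_mono_set h1 ?_ (Ioi_subset_Ioi (zero_le_one (α := ℝ))).eventuallyLE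
  filter_upwards [ae_restrict_mem measurableSet_Ioi] with t ht
  have ht' : 0 < t := ht
  simp only [Pi.zero_apply]
  positivity

lemma integrable_tsum' {α : Type*} [MeasurableSpace α] {μ : Measure α} {F : ℕ → α → ℝ}
    (hF : ∀ i, Integrable (F i) μ) (hs : Summable fun i => ∫ a, ‖F i a‖ ∂μ)
    (hm : AEStronglyMeasurable (fun a => ∑' i, F i a) μ) :
    Integrable (fun a => ∑' i, F i a) μ := by
  refine ⟨hm, ?_⟩
  have h1 : ∫⁻ a, ‖∑' i, F i a‖ₑ ∂μ ≤ ∫⁻ a, ∑' i, ‖F i a‖ₑ ∂μ :=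
    lintegral_mono fun a => enorm_tsum_le_tsum_enorm
  refine h1.trans_lt ?_
  rw [lintegral_tsum fun i => (hF i).1.enorm]
  have : ∀ i, ∫⁻ a, ‖F i a‖ₑ ∂μ = ENNReal.ofReal (∫ a, ‖F i a‖ ∂μ) := fun i =>
    (ofReal_integral_norm_eq_lintegral_enorm (hF i)).symm
  simp_rw [this]
  exact hs.tsum_ofReal_lt_top

lemma core {m A w : ℝ} (hm : 0 < m) (hA : 0 < A) (hw : 0 ≤ w) (hw1 : w < 1) :
    IntegrableOn (fun t : ℝ => Real.log t * (Real.exp (-A * t) * kummerM m (w * A * t))) (Ioi 1) ∧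
    HasSum (fun i : ℕ => poch m i / ((Nat.factorial i : ℝ) ^ 2) * (w * A) ^ i *
      ∫ t in Ioi (1 : ℝ), Real.log t * t ^ i * Real.exp (-A * t))
      (∫ t in Ioi (1:ℝ), Real.log t * (Real.exp (-A * t) * kummerM m (w * A * t))) ∧
    ∫ t in Ioi (1:ℝ), Real.log t * (Real.exp (-A * t) * kummerM m (w * A * t))
      ≤ (1 + m) * (1 / (1 - w) ^ (m + 1)) / A ^ 2 := by
  set F : ℕ → ℝ → ℝ := fun i t => poch m i / ((Nat.factorial i : ℝ) ^ 2) * (w * A) ^ i *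
    (Real.log t * t ^ i * Real.exp (-A * t)) with hFdef
  have hFi : ∀ i, IntegrableOn (F i) (Ioi 1) := fun i => (logTerm hA i).1.const_mul _
  have hFint : ∀ i, ∫ t in Ioi (1:ℝ), F i t = poch m i / ((Nat.factorial i : ℝ) ^ 2) * (w * A) ^ i *
      ∫ t in Ioi (1 : ℝ), Real.log t * t ^ i * Real.exp (-A * t) := fun i => integral_const_mul _ _
  have hF0 : ∀ i, ∀ t ∈ Ioi (1:ℝ), 0 ≤ F i t := by
    intro i t ht
    have ht' : 1 < t := ht
    have := Real.log_pos ht'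
    have := poch_pos hm i
    simp only [hFdef]
    positivity
  have hFn : ∀ i, ∫ t in Ioi (1:ℝ), ‖F i t‖ = ∫ t in Ioi (1:ℝ), F i t := fun i =>
    setIntegral_congr_fun measurableSet_Ioi fun t ht => Real.norm_of_nonneg (hF0 i t ht)
  have hbs : HasSum (fun i : ℕ => (1 + m) / A ^ 2 *
      (poch (m + 1) i / (Nat.factorial i : ℝ) * w ^ i)) ((1 + m) / A ^ 2 * (1 / (1 - w) ^ (m + 1))) :=
    (negbin hw hw1).mul_left _
  have hb : ∀ i, ∫ t in Ioi (1:ℝ), F i t ≤ (1 + m) / A ^ 2 *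
      (poch (m + 1) i / (Nat.factorial i : ℝ) * w ^ i) := by
    intro i
    rw [hFint]
    have := poch_pos hm i
    have hwt := poch_weight hm i
    calc _ ≤ poch m i / ((Nat.factorial i : ℝ) ^ 2) * (w * A) ^ i *
          ((Nat.factorial (i + 1) : ℝ) / A ^ (i + 2)) := by
            gcongr
            exact (logTerm hA i).2
      _ = (poch m i * (i + 1)) * (w ^ i / (Nat.factorial i : ℝ) / A ^ 2) := by
            rw [Nat.factorial_succ]; rw [mul_pow, pow_add]; push_cast; field_simp
      _ ≤ ((1 + m) * poch (m + 1) i) * (w ^ i / (Nat.factorial i : ℝ) / A ^ 2) := by gcongr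
      _ = _ := by ring
  have hnn : ∀ i, 0 ≤ ∫ t in Ioi (1:ℝ), F i t := fun i =>
    setIntegral_nonneg measurableSet_Ioi (hF0 i)
  have hs : Summable fun i => ∫ t in Ioi (1:ℝ), ‖F i t‖ := by
    simp_rw [hFn]
    exact Summable.of_nonneg_of_le hnn hb hbs.summable
  have heq : (fun t : ℝ => Real.log t * (Real.exp (-A * t) * kummerM m (w * A * t)))
      = fun t => ∑' i, F i t := by
    ext t
    rw [kummerM, ← mul_assoc, ← tsum_mul_left]
    congr 1; ext i
    simp only [hFdef]; rw [mul_pow (w * A)]; ring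
  have hmeas : Measurable (fun t : ℝ => Real.log t * (Real.exp (-A * t) * kummerM m (w * A * t))) := by
    have := (kummer_measurable hm).comp (g := kummerM m) (f := fun t : ℝ => w * A * t) (by fun_prop)
    have h2 : Measurable (fun t : ℝ => kummerM m (w * A * t)) := this
    fun_prop
  have hsum := hasSum_integral_of_summable_integral_norm hFi hs
  simp_rw [hFint] at hsum
  rw [heq] at hmeas
  rw [heq]
  refine ⟨integrable_tsum' hFi hs hmeas.aestronglyMeasurable, hsum, ?_⟩
  simp_rw [← hFint] at hsum
  refine (hasSum_le hb hsum hbs).trans_eq ?_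
  ring

lemma condPdf_measurable {m k γb : ℝ} (hm : 0 < m) :
    Measurable (fun p : ℝ × ℝ => condPdf m k γb p.1 p.2) := by
  have h := (kummer_measurable hm).comp (g := kummerM m) (f := fun p : ℝ × ℝ =>
    (k / p.1) * (1 + k / p.1) / (k / p.1 + m) * (p.2 / ((k + p.1) / (k + 1) * γb))) (by fun_prop)
  simp only [Function.comp_def] at h
  unfold condPdf
  fun_prop

lemma condPdf_eq {m k γb γ₀ x t : ℝ} (hm : 0 < m) (hk : 0 < k) (hγb : 0 < γb) (hx : 0 < x) :
    condPdf m k γb x (γ₀ * t) =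
      (m ^ m * (k + 1) * x ^ (m - 1) / ((k + m * x) ^ m * γb)) *
      (Real.exp (-((k + 1) * γ₀ / (x * γb)) * t) *
        kummerM m (k / (k + m * x) * ((k + 1) * γ₀ / (x * γb)) * t)) := by
  have hkm : 0 < k + m * x := by positivity
  have hkx : 0 < k + x := by positivity
  have e1 : m + k / x = (k + m * x) / x := by field_simp; ring
  have e2 : 1 + k / x = (k + x) / x := by field_simp; ring
  have h1 : 0 < m ^ m := by positivity
  have h2 : 0 < x ^ m := by positivity
  have h3 : 0 < (k + m * x) ^ m := by positivity
  unfold condPdf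
  rw [add_comm (k / x) m, e1, e2, Real.div_rpow hkm.le hx.le, Real.rpow_sub_one hx.ne', mul_assoc]
  congr 1
  · field_simp
  · congr 2
    · field_simp
    · field_simp

/-- Series form of the OPRA capacity (eq. (30) in the proof of Theorem 5). -/
theorem opra_capacity_series_form (m k γb γ₀ : ℝ) (hm : 0 < m) (hk : 0 < k)
    (hγb : 0 < γb) (hγ₀ : 0 < γ₀) :
    IntegrableOn (fun γ : ℝ => Real.logb 2 (γ / γ₀) * pdfSNR m k γb γ) (Ioi γ₀) ∧
    (∀ x ∈ Ioi (0 : ℝ), ∀ i : ℕ, IntegrableOn (fun t : ℝ =>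
      Real.log t * t ^ i * Real.exp (-((k + 1) * γ₀ / (x * γb)) * t)) (Ioi 1)) ∧
    (∀ x ∈ Ioi (0 : ℝ), Summable (fun i : ℕ =>
      poch m i / ((Nat.factorial i : ℝ) ^ 2) *
        (k * (k + 1) * γ₀ / (x * (k + m * x) * γb)) ^ i *
        ∫ t in Ioi (1 : ℝ), Real.log t * t ^ i *
          Real.exp (-((k + 1) * γ₀ / (x * γb)) * t))) ∧
    IntegrableOn (fun x : ℝ =>
      (m ^ m * (k + 1) * x ^ (m - 1) / ((k + m * x) ^ m * γb)) * Real.exp (-x) *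
        ∑' i : ℕ, poch m i / ((Nat.factorial i : ℝ) ^ 2) *
          (k * (k + 1) * γ₀ / (x * (k + m * x) * γb)) ^ i *
          ∫ t in Ioi (1 : ℝ), Real.log t * t ^ i *
            Real.exp (-((k + 1) * γ₀ / (x * γb)) * t)) (Ioi 0) ∧
    (∫ γ in Ioi γ₀, Real.logb 2 (γ / γ₀) * pdfSNR m k γb γ) =
      (γ₀ / Real.log 2) * ∫ x in Ioi (0 : ℝ),
        (m ^ m * (k + 1) * x ^ (m - 1) / ((k + m * x) ^ m * γb)) * Real.exp (-x) *
          ∑' i : ℕ, poch m i / ((Nat.factorial i : ℝ) ^ 2) *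
            (k * (k + 1) * γ₀ / (x * (k + m * x) * γb)) ^ i *
            ∫ t in Ioi (1 : ℝ), Real.log t * t ^ i *
              Real.exp (-((k + 1) * γ₀ / (x * γb)) * t) := by
  set A : ℝ → ℝ := fun x => (k + 1) * γ₀ / (x * γb) with hAdef
  set w : ℝ → ℝ := fun x => k / (k + m * x) with hwdef
  set P : ℝ → ℝ := fun x => m ^ m * (k + 1) * x ^ (m - 1) / ((k + m * x) ^ m * γb) with hPdef
  have hA : ∀ x, 0 < x → 0 < A x := fun x hx => by simp only [hAdef]; positivity
  have hw : ∀ x, 0 < x → 0 ≤ w x := fun x hx => by simp only [hwdef]; positivity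
  have hw1 : ∀ x, 0 < x → w x < 1 := fun x hx => by
    simp only [hwdef]
    rw [div_lt_one (by positivity)]
    have := mul_pos hm hx
    linarith
  have hwA : ∀ x, 0 < x → k * (k + 1) * γ₀ / (x * (k + m * x) * γb) = w x * A x := fun x hx => by
    simp only [hwdef, hAdef]
    have : 0 < k + m * x := by positivity
    field_simp
  set I : ℝ → ℝ := fun x => ∫ t in Ioi (1:ℝ),
    Real.log t * (Real.exp (-A x * t) * kummerM m (w x * A x * t)) with hIdef
  have hcore := fun x (hx : 0 < x) => core hm (hA x hx) (hw x hx) (hw1 x hx)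
  have hsum : ∀ x, 0 < x → HasSum (fun i : ℕ =>
      poch m i / ((Nat.factorial i : ℝ) ^ 2) *
        (k * (k + 1) * γ₀ / (x * (k + m * x) * γb)) ^ i *
        ∫ t in Ioi (1 : ℝ), Real.log t * t ^ i * Real.exp (-A x * t)) (I x) := by
    intro x hx
    rw [hwA x hx]
    exact (hcore x hx).2.1
  have hcond : ∀ x, 0 < x → ∀ t, condPdf m k γb x (γ₀ * t) =
      P x * (Real.exp (-A x * t) * kummerM m (w x * A x * t)) :=
    fun x hx t => condPdf_eq hm hk hγb hx
  have hHx : ∀ x, 0 < x → (fun t => Real.log t * (condPdf m k γb x (γ₀ * t) * Real.exp (-x))) =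
      fun t => P x * Real.exp (-x) *
        (Real.log t * (Real.exp (-A x * t) * kummerM m (w x * A x * t))) := by
    intro x hx
    ext t
    rw [hcond x hx t]
    ring
  have hHint : ∀ x, 0 < x →
      ∫ t in Ioi (1:ℝ), Real.log t * (condPdf m k γb x (γ₀ * t) * Real.exp (-x)) =
        P x * Real.exp (-x) * I x := by
    intro x hx
    rw [hHx x hx, integral_const_mul]
  have hmeas : Measurable (fun p : ℝ × ℝ =>
      Real.log p.1 * (condPdf m k γb p.2 (γ₀ * p.1) * Real.exp (-p.2))) := by
    have h := condPdf_measurable (k := k) (γb := γb) hm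
    have h2 : Measurable (fun p : ℝ × ℝ => condPdf m k γb p.2 (γ₀ * p.1)) :=
      h.comp (g := fun p : ℝ × ℝ => condPdf m k γb p.1 p.2)
        (f := fun p : ℝ × ℝ => (p.2, γ₀ * p.1)) (by fun_prop)
    fun_prop
  have hnn : ∀ x, 0 < x → ∀ t, 1 < t →
      0 ≤ Real.log t * (condPdf m k γb x (γ₀ * t) * Real.exp (-x)) := by
    intro x hx t ht
    rw [hcond x hx]
    have h1 := Real.log_pos ht
    have h2 := hw x hx
    have h3 := hA x hx
    have h4 : 0 ≤ kummerM m (w x * A x * t) := tsum_nonneg fun i => by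
      have := poch_pos hm i
      positivity
    have h5 : 0 ≤ P x := by simp only [hPdef]; positivity
    positivity
  have hbound : ∀ x, 0 < x → P x * Real.exp (-x) * I x ≤
      (1 + m) * γb / (γ₀ ^ 2 * (k + 1) * m) * ((k + m * x) * Real.exp (-x)) := by
    intro x hx
    have hI := (hcore x hx).2.2
    have h5 : 0 ≤ P x := by simp only [hPdef]; positivity
    calc P x * Real.exp (-x) * I x ≤ P x * Real.exp (-x) *
          ((1 + m) * (1 / (1 - w x) ^ (m + 1)) / A x ^ 2) := by gcongr
      _ = _ := by
        have h1w : 1 - w x = m * x / (k + m * x) := by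
          simp only [hwdef]
          have : 0 < k + m * x := by positivity
          field_simp
          ring
        rw [h1w]
        simp only [hPdef, hAdef]
        have hkm : 0 < k + m * x := by positivity
        rw [Real.rpow_add_one (by positivity), Real.div_rpow (by positivity) hkm.le,
          Real.mul_rpow hm.le hx.le, Real.rpow_sub_one hx.ne']
        have h1 : 0 < m ^ m := by positivity
        have h2 : 0 < x ^ m := by positivity
        have h3 : 0 < (k + m * x) ^ m := by positivity
        field_simp
  have hbi : IntegrableOn (fun x => (1 + m) * γb / (γ₀ ^ 2 * (k + 1) * m) *
      ((k + m * x) * Real.exp (-x))) (Ioi 0) := by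
    have h1 : IntegrableOn (fun x : ℝ => Real.exp (-x)) (Ioi 0) := integrableOn_exp_neg_Ioi 0
    have h2 := (gammaInt one_pos 0).1
    have h3 := ((h1.const_mul k).add (h2.const_mul m)).const_mul
      ((1 + m) * γb / (γ₀ ^ 2 * (k + 1) * m))
    refine IntegrableOn.congr_fun h3 (fun x _ => ?_) measurableSet_Ioi
    simp only [Pi.add_apply, zero_add, pow_one, neg_mul, one_mul]
    ring
  have hprod : Integrable (Function.uncurry fun t x : ℝ =>
      Real.log t * (condPdf m k γb x (γ₀ * t) * Real.exp (-x)))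
      ((volume.restrict (Ioi (1:ℝ))).prod (volume.restrict (Ioi (0:ℝ)))) := by
    have hsm : AEStronglyMeasurable (Function.uncurry fun t x : ℝ =>
      Real.log t * (condPdf m k γb x (γ₀ * t) * Real.exp (-x)))
      ((volume.restrict (Ioi (1:ℝ))).prod (volume.restrict (Ioi (0:ℝ)))) :=
      hmeas.aestronglyMeasurable
    rw [integrable_prod_iff' hsm]
    constructor
    · filter_upwards [ae_restrict_mem measurableSet_Ioi] with x hx
      simp only [Function.uncurry]
      rw [hHx x hx]
      exact (hcore x hx).1.const_mul _
    · refine Integrable.mono' hbi hsm.prod_swap.norm.integral_prod_right' ?_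
      filter_upwards [ae_restrict_mem measurableSet_Ioi] with x hx
      rw [Real.norm_of_nonneg (integral_nonneg fun _ => norm_nonneg _)]
      refine le_trans (le_of_eq ?_) (hbound x hx)
      rw [← hHint x hx]
      exact setIntegral_congr_fun measurableSet_Ioi fun t ht => Real.norm_of_nonneg (hnn x hx t ht)
  have hleft := hprod.integral_prod_left
  have hright := hprod.integral_prod_right
  have hswap := integral_integral_swap hprod
  have hpdf : ∀ t, ∫ x in Ioi (0:ℝ), Real.log t * (condPdf m k γb x (γ₀ * t) * Real.exp (-x)) =
      Real.log t * pdfSNR m k γb (γ₀ * t) := fun t => integral_const_mul _ _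
  simp only [Function.uncurry, hpdf] at hleft hright hswap
  have hγ : ∀ t, Real.logb 2 (γ₀ * t / γ₀) * pdfSNR m k γb (γ₀ * t) =
      (1 / Real.log 2) * (Real.log t * pdfSNR m k γb (γ₀ * t)) := by
    intro t
    rw [mul_div_cancel_left₀ _ hγ₀.ne', Real.logb]
    ring
  have hser : ∀ x ∈ Ioi (0:ℝ), ∫ t in Ioi (1:ℝ),
      Real.log t * (condPdf m k γb x (γ₀ * t) * Real.exp (-x)) = P x * Real.exp (-x) *
        ∑' i : ℕ, poch m i / ((Nat.factorial i : ℝ) ^ 2) *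
        (k * (k + 1) * γ₀ / (x * (k + m * x) * γb)) ^ i *
        ∫ t in Ioi (1 : ℝ), Real.log t * t ^ i * Real.exp (-A x * t) := by
    intro x hx
    rw [(hsum x hx).tsum_eq, hHint x hx]
  refine ⟨?_, fun x hx i => (logTerm (hA x hx) i).1, fun x hx => (hsum x hx).summable, ?_, ?_⟩
  · have h := integrableOn_Ioi_comp_mul_left_iff
      (fun γ : ℝ => Real.logb 2 (γ / γ₀) * pdfSNR m k γb γ) 1 hγ₀
    rw [mul_one] at h
    rw [← h]
    simp only [hγ]
    exact hleft.const_mul _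
  · exact IntegrableOn.congr_fun hright hser measurableSet_Ioi
  · have h := integral_comp_mul_left_Ioi'
      (fun γ : ℝ => Real.logb 2 (γ / γ₀) * pdfSNR m k γb γ) 1 hγ₀
    rw [mul_one] at h
    simp only [hγ] at h
    rw [integral_const_mul, hswap, setIntegral_congr_fun measurableSet_Ioi hser, smul_eq_mul] at h
    rw [← h]
    ring
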